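/- arXiv:1007.1253 — 11 statements merged into one kernel-verified Lean document; each statement's English description precedes it below -/
import Mathlib

section
/- Let d ≥ 2 and s ≥ 1 be integers, and let (e_1, …, e_s) be a d-uniform hypergraph on a finite vertex set V (each e_j ⊆ V with |e_j| = d) such that the union ⋃_{j=1}^s e_j has exactly s(d−1)+1 vertices. Then there exists an index j such that at least d−1 of the vertices of e_j are isolated in e_j, i.e., belong to no e_i with i ≠ j. (First part of the paper's Lemma on hypertrees: every hypertree has a hyperedge incident on at least d−1 isolated vertices.) -/
/-- In a finite family of finsets, twice the size of the union is at most the sum of the sizes of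
the members plus the sum of the numbers of their isolated vertices. -/
theorem two_mul_card_biUnion_le_sum_card_add_sum_card_isolated
    {V ι : Type*} [DecidableEq V] [Fintype ι] (e : ι → Finset V)
    [∀ j, DecidablePred fun v => ∀ i, i ≠ j → v ∉ e i] :
    2 * (Finset.univ.biUnion e).card ≤
      ∑ j, (e j).card + ∑ j, ((e j).filter (fun v => ∀ i, i ≠ j → v ∉ e i)).card := by
  have double_count (f : ι → Finset V) (hf : ∀ j, f j ⊆ e j) :
      ∑ j, (f j).card =
        ∑ v ∈ Finset.univ.biUnion e, (Finset.univ.filter (fun j => v ∈ f j)).card := by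
    simp only [Finset.card_filter]
    rw [Finset.sum_comm]
    refine Finset.sum_congr rfl fun j _ => ?_
    rw [← Finset.card_filter, Finset.filter_mem_eq_inter, Finset.inter_eq_right.mpr]
    exact (hf j).trans (Finset.subset_biUnion_of_mem e (Finset.mem_univ j))
  rw [double_count e fun _ => Finset.Subset.rfl,
    double_count _ fun j => Finset.filter_subset _ (e j), ← Finset.sum_add_distrib, mul_comm,
    ← smul_eq_mul]
  refine Finset.card_nsmul_le_sum _ _ _ fun v hv => ?_
  obtain ⟨j, -, hj⟩ := Finset.mem_biUnion.mp hv
  by_cases h : ∀ i, i ≠ j → v ∉ e i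
  · have h₁ : 0 < (Finset.univ.filter (fun i => v ∈ e i)).card :=
      Finset.card_pos.mpr ⟨j, by simpa using hj⟩
    have h₂ : 0 < (Finset.univ.filter
        (fun k => v ∈ (e k).filter (fun v => ∀ i, i ≠ k → v ∉ e i))).card :=
      Finset.card_pos.mpr ⟨j, by simpa using ⟨hj, h⟩⟩
    omega
  · push Not at h
    obtain ⟨i, hij, hi⟩ := h
    have h₁ : 1 < (Finset.univ.filter (fun i => v ∈ e i)).card :=
      Finset.one_lt_card.mpr ⟨i, by simpa using hi, j, by simpa using hj, hij⟩
    omega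


/-- **Hypertree has a hyperedge with at least `d-1` isolated vertices.**
A `d`-uniform hypergraph `(e 1, …, e s)` on a vertex set `V` whose union of
hyperedges has exactly `s*(d-1)+1` vertices (a hypertree) has a hyperedge `j`
at least `d-1` of whose vertices are isolated, i.e. belong to no other hyperedge. -/
theorem hypertree_exists_edge_with_isolated_vertices
    {V : Type*} [DecidableEq V] (d s : ℕ) (hd : 2 ≤ d) (hs : 1 ≤ s)
    (e : Fin s → Finset V)
    (hcard : ∀ j, (e j).card = d)
    (hunion : (Finset.univ.biUnion e).card = s * (d - 1) + 1) :
    ∃ j : Fin s,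
      d - 1 ≤ ((e j).filter (fun v => ∀ i : Fin s, i ≠ j → v ∉ e i)).card := by
  by_contra! h
  have key := two_mul_card_biUnion_le_sum_card_add_sum_card_isolated e
  have hle := Finset.sum_le_card_nsmul Finset.univ
    (fun j => ((e j).filter (fun v => ∀ i, i ≠ j → v ∉ e i)).card) (d - 2)
    fun j _ => by have := h j; omega
  obtain ⟨k, rfl⟩ := Nat.exists_eq_add_of_le hd
  simp only [hunion, hcard, Finset.sum_const, Finset.card_univ, Fintype.card_fin, smul_eq_mul,
    Nat.add_sub_cancel_left, show 2 + k - 1 = k + 1 by omega] at key hle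
  nlinarith
end

section
/- Let d ≥ 2 and s ≥ 1 be integers, and let (e_1, …, e_s) be a d-uniform hypergraph on a finite vertex set V that is connected and whose union ⋃_{j=1}^s e_j has exactly s(d−1) vertices (a unicyclic hypergraph). Then either (i) there exists an index j such that at least d−1 vertices of e_j are isolated in e_j, or (ii) there exists an index j such that exactly d−2 vertices of e_j are isolated in e_j and the hypergraph (e_i)_{i ≠ j} obtained by removing e_j is connected and its union has exactly (s−1)(d−1)+1 vertices (i.e., it is a hypertree). -/
/-- In a finite set with a symmetric relation that connects it, some element can be removed
without destroying connectedness. -/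
theorem exists_reflTransGen_ne {ι : Type*} [Finite ι] [Nontrivial ι] (r : ι → ι → Prop)
    (hr : ∀ p q, r p q → r q p) (hconn : ∀ a b, Relation.ReflTransGen r a b) :
    ∃ j, ∀ a b, a ≠ j → b ≠ j →
      Relation.ReflTransGen (fun p q => p ≠ j ∧ q ≠ j ∧ r p q) a b := by
  have hG : (SimpleGraph.fromRel r).Connected := by
    refine (SimpleGraph.connected_iff _).2 ⟨fun a b => ?_, inferInstance⟩
    induction hconn a b with
    | refl => exact SimpleGraph.Reachable.refl a
    | @tail p q _ hpq ih =>
      by_cases h : p = q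
      · exact h ▸ ih
      · exact ih.trans (SimpleGraph.Adj.reachable
          ((SimpleGraph.fromRel_adj r p q).2 ⟨h, Or.inl hpq⟩))
  obtain ⟨j, hj⟩ := hG.exists_connected_induce_compl_singleton_of_finite_nontrivial
  refine ⟨j, fun a b ha hb => ?_⟩
  have hab := (SimpleGraph.reachable_iff_reflTransGen _ _).1
    (hj.preconnected ⟨a, ha⟩ ⟨b, hb⟩)
  refine hab.lift Subtype.val fun p q hpq => ?_
  obtain ⟨-, h | h⟩ := (SimpleGraph.fromRel_adj r p q).1 hpq
  exacts [⟨p.2, q.2, h⟩, ⟨p.2, q.2, hr _ _ h⟩]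

/-- The sum of the sizes of the sets in a family is the sum of the degrees of the vertices of any
set containing them all. -/
theorem sum_card_eq_sum_degree {ι V : Type*} [Fintype ι] [DecidableEq V] (e : ι → Finset V)
    (U : Finset V) (hU : ∀ j, e j ⊆ U) :
    ∑ j, (e j).card = ∑ v ∈ U, (Finset.univ.filter fun j => v ∈ e j).card := by
  refine Eq.trans ?_ (Finset.sum_card_bipartiteAbove_eq_sum_card_bipartiteBelow
    fun j v => v ∈ e j)
  refine Finset.sum_congr rfl fun j _ => congrArg Finset.card ?_
  ext v
  simpa [Finset.bipartiteAbove] using fun h => hU j h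

/-- Every vertex of the union is either isolated in a hyperedge or in at least two hyperedges, so
twice the size of the union is at most the total size of the hyperedges plus the total number of
isolated vertices. -/
theorem two_mul_card_biUnion_le {ι V : Type*} [Fintype ι] [DecidableEq V] (e : ι → Finset V)
    [∀ j, DecidablePred fun v => ∀ i, i ≠ j → v ∉ e i] :
    2 * (Finset.univ.biUnion e).card ≤
      ∑ j, (e j).card + ∑ j, ((e j).filter fun v => ∀ i, i ≠ j → v ∉ e i).card := by
  have hU : ∀ j, e j ⊆ Finset.univ.biUnion e := fun j =>
    Finset.subset_biUnion_of_mem e (Finset.mem_univ j)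
  rw [sum_card_eq_sum_degree e _ hU,
    sum_card_eq_sum_degree _ _ fun j => (Finset.filter_subset _ _).trans (hU j),
    ← Finset.sum_add_distrib, mul_comm, ← smul_eq_mul]
  refine Finset.card_nsmul_le_sum _ _ _ fun v hv => ?_
  obtain ⟨j, -, hj⟩ := Finset.mem_biUnion.1 hv
  by_cases h : ∀ i, i ≠ j → v ∉ e i
  · refine Nat.add_le_add (a := 1) (c := 1)
      (Finset.card_pos.2 ⟨j, ?_⟩) (Finset.card_pos.2 ⟨j, ?_⟩)
    · simpa using hj
    · simpa [hj] using h
  · push Not at h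
    obtain ⟨i, hij, hi⟩ := h
    refine le_add_right (Finset.one_lt_card.2 ⟨i, ?_, j, ?_, hij⟩) <;> simpa

/-- Removing a hyperedge removes exactly its isolated vertices from the union. -/
theorem card_biUnion_erase_add {ι V : Type*} [Fintype ι] [DecidableEq ι] [DecidableEq V]
    (e : ι → Finset V) (j : ι) [DecidablePred fun v => ∀ i, i ≠ j → v ∉ e i] :
    ((Finset.univ.erase j).biUnion e).card +
      ((e j).filter fun v => ∀ i, i ≠ j → v ∉ e i).card = (Finset.univ.biUnion e).card := by
  rw [← Finset.card_union_of_disjoint]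
  · congr 1
    ext v
    simp only [Finset.mem_union, Finset.mem_biUnion, Finset.mem_erase, Finset.mem_filter,
      Finset.mem_univ, and_true, true_and]
    grind
  · rw [Finset.disjoint_left]
    simp only [Finset.mem_biUnion, Finset.mem_erase, Finset.mem_filter]
    grind

/-- **Unicyclic hypergraph lemma.**
A connected `d`-uniform hypergraph `(e 1, …, e s)` whose union of hyperedges has
exactly `s*(d-1)` vertices (a unicyclic component) either has a hyperedge with at
least `d-1` isolated vertices, or has a hyperedge with exactly `d-2` isolated
vertices whose removal leaves a connected hypergraph whose union has exactly
`(s-1)*(d-1)+1` vertices (i.e. a hypertree). -/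
theorem unicyclic_exists_good_edge
    {V : Type*} [DecidableEq V] (d s : ℕ) (hd : 2 ≤ d) (hs : 1 ≤ s)
    (e : Fin s → Finset V)
    (hcard : ∀ j, (e j).card = d)
    (hconn : ∀ a b : Fin s,
      Relation.ReflTransGen (fun p q : Fin s => (e p ∩ e q).Nonempty) a b)
    (hunion : (Finset.univ.biUnion e).card = s * (d - 1)) :
    (∃ j : Fin s,
        d - 1 ≤ ((e j).filter (fun v => ∀ i : Fin s, i ≠ j → v ∉ e i)).card) ∨
    (∃ j : Fin s,
        ((e j).filter (fun v => ∀ i : Fin s, i ≠ j → v ∉ e i)).card = d - 2 ∧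
        (∀ a b : Fin s, a ≠ j → b ≠ j →
          Relation.ReflTransGen
            (fun p q : Fin s => p ≠ j ∧ q ≠ j ∧ (e p ∩ e q).Nonempty) a b) ∧
        ((Finset.univ.erase j).biUnion e).card = (s - 1) * (d - 1) + 1) := by
  rw [or_iff_not_imp_left]
  intro hsmall
  push Not at hsmall
  obtain ⟨k, rfl⟩ := Nat.exists_eq_add_of_le' hd
  have hle : ∀ j ∈ Finset.univ,
      ((e j).filter fun v => ∀ i : Fin s, i ≠ j → v ∉ e i).card ≤ k := fun j _ => by
    have := hsmall j
    omega
  have hcount := two_mul_card_biUnion_le e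
  simp only [hunion, hcard, Finset.sum_const, Finset.card_univ, Fintype.card_fin, smul_eq_mul,
    Nat.add_succ_sub_one] at hcount
  have hsum : ∑ j, ((e j).filter fun v => ∀ i : Fin s, i ≠ j → v ∉ e i).card =
      ∑ _j : Fin s, k := by
    refine le_antisymm (Finset.sum_le_sum hle) ?_
    simp only [Finset.sum_const, Finset.card_univ, Fintype.card_fin, smul_eq_mul]
    nlinarith
  have heq := (Finset.sum_eq_sum_iff_of_le hle).1 hsum
  obtain ⟨m, rfl⟩ : ∃ m, s = m + 2 := by
    refine Nat.exists_eq_add_of_le' (Nat.lt_of_le_of_ne hs ?_)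
    rintro rfl
    have h := Finset.card_le_card (Finset.subset_biUnion_of_mem e (Finset.mem_univ 0))
    rw [hunion, hcard] at h
    omega
  obtain ⟨j, hj⟩ := exists_reflTransGen_ne (fun p q => (e p ∩ e q).Nonempty)
    (fun p q h => by rwa [Finset.inter_comm]) hconn
  refine ⟨j, heq j (Finset.mem_univ j), hj, ?_⟩
  have h := card_biUnion_erase_add e j
  rw [heq j (Finset.mem_univ j), hunion] at h
  simp only [Nat.add_succ_sub_one] at h ⊢
  linarith
end

section
/- Let ι be a finite type, let ∼ be an equivalence relation on ι, and for each i let D_i denote the cardinality of the equivalence class of i. Let Y : ι → ℝ and v : ι → ℝ satisfy |v_i| ≤ 2 · Σ_{j : j ∼ i} |Y_j| for every i. Then Σ_{i} v_i² ≤ 4 · Σ_{i} D_i² Y_i². (This is the paper's Corollary bounding the total squared error ‖x′ − x_S‖₂² ≤ 4 Σ_i D_i² Y_i² given the pointwise deviation bound |(x′ − x_S)_i| ≤ 2 Σ_{j in the same component as i} |Y_j|, where D_i is the number of hyperedges in the same component as i.) -/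
/-- **Total squared error in terms of point errors and component sizes.**
If `∼` is an equivalence relation on a finite index type, `D i` is the size of the
class of `i`, and `|v i| ≤ 2 * ∑_{j ∼ i} |Y j|` for every `i`, then
`∑ i, (v i)² ≤ 4 * ∑ i, (D i)² * (Y i)²`. -/
theorem total_error_le_point_error
    {ι : Type*} [Fintype ι] (r : ι → ι → Prop) [DecidableRel r]
    (hr : Equivalence r) (Y v : ι → ℝ)
    (hv : ∀ i, |v i| ≤ 2 * ∑ j ∈ Finset.univ.filter (fun j => r j i), |Y j|) :
    ∑ i, (v i) ^ 2 ≤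
      4 * ∑ i, ((Finset.univ.filter (fun j => r j i)).card : ℝ) ^ 2 * (Y i) ^ 2 := by
  have card_eq : ∀ i j, r j i → (Finset.univ.filter (fun k => r k i)).card =
      (Finset.univ.filter (fun k => r k j)).card := fun i j hji =>
    congrArg Finset.card <| Finset.filter_congr fun k _ =>
      ⟨fun h => hr.trans h (hr.symm hji), fun h => hr.trans h hji⟩
  have sq_le : ∀ i, (v i) ^ 2 ≤ ∑ j ∈ Finset.univ.filter (fun j => r j i),
      4 * (((Finset.univ.filter (fun k => r k j)).card : ℝ) * (Y j) ^ 2) := fun i =>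
    calc (v i) ^ 2 = |v i| ^ 2 := (sq_abs _).symm
      _ ≤ (2 * ∑ j ∈ Finset.univ.filter (fun j => r j i), |Y j|) ^ 2 := by
        gcongr
        exact hv i
      _ = 4 * (∑ j ∈ Finset.univ.filter (fun j => r j i), |Y j|) ^ 2 := by ring
      _ ≤ 4 * (((Finset.univ.filter (fun j => r j i)).card : ℝ) *
            ∑ j ∈ Finset.univ.filter (fun j => r j i), |Y j| ^ 2) := by
        gcongr
        exact sq_sum_le_card_mul_sum_sq
      _ = _ := by
        rw [Finset.mul_sum, Finset.mul_sum]
        refine Finset.sum_congr rfl fun j hj => ?_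
        rw [card_eq i j (Finset.mem_filter.mp hj).2, sq_abs]
  refine (Finset.sum_le_sum fun i _ => sq_le i).trans_eq ?_
  simp_rw [Finset.sum_filter]
  rw [Finset.sum_comm, Finset.mul_sum]
  refine Finset.sum_congr rfl fun j _ => ?_
  have comm : Finset.univ.filter (fun i => r j i) = Finset.univ.filter (fun i => r i j) :=
    Finset.filter_congr fun i _ => ⟨hr.symm, hr.symm⟩
  rw [← Finset.sum_filter, Finset.sum_const, comm, nsmul_eq_mul]
  ring
end

section
/- Let W and F be independent nonnegative real random variables on a probability space, and let μ > 0. Suppose P(W ≥ t) ≤ μ/t for every t > 0, and suppose the law of F has density f(x) = 1/x² for x ≥ 1 and f(x) = 0 for x < 1 (with respect to Lebesgue measure). Then for every c ≥ 1, P(W·F ≥ cμ) ≤ (1 + ln c)/c. -/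
open MeasureTheory ProbabilityTheory

/-- The part of the truncated integral where the tail bound is smaller than `1`. -/
lemma lintegral_Icc_one_ofReal_inv_div {c : ℝ} (hc : 1 ≤ c) :
    ∫⁻ x in Set.Icc 1 c, ENNReal.ofReal (x⁻¹ / c) = ENNReal.ofReal (Real.log c / c) := by
  have hint : IntegrableOn (fun x : ℝ => x⁻¹ / c) (Set.Icc 1 c) :=
    ((continuousOn_id.inv₀ fun x hx => (zero_lt_one.trans_le hx.1).ne').div_const
      c).integrableOn_Icc
  rw [← ofReal_integral_eq_lintegral_ofReal hint, integral_Icc_eq_integral_Ioc,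
    ← intervalIntegral.integral_of_le hc, intervalIntegral.integral_div,
    integral_inv_of_pos one_pos (by linarith), div_one]
  filter_upwards [ae_restrict_mem measurableSet_Icc] with x hx
  exact div_nonneg (inv_nonneg.2 (zero_le_one.trans hx.1)) (by linarith)

lemma lintegral_Ioi_ofReal_one_div_sq {c : ℝ} (hc : 0 < c) :
    ∫⁻ x in Set.Ioi c, ENNReal.ofReal (1 / x ^ 2) = ENNReal.ofReal (1 / c) := by
  have heq : Set.EqOn (fun x : ℝ => x ^ (-2 : ℝ)) (fun x => 1 / x ^ 2) (Set.Ioi c) := by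
    intro x hx
    have hx0 : 0 < x := hc.trans hx
    simp [Real.rpow_neg hx0.le]
  have hint : IntegrableOn (fun x : ℝ => 1 / x ^ 2) (Set.Ioi c) :=
    (integrableOn_Ioi_rpow_of_lt (by norm_num) hc).congr_fun heq measurableSet_Ioi
  rw [← ofReal_integral_eq_lintegral_ofReal hint (ae_of_all _ fun x => by positivity),
    ← setIntegral_congr_fun measurableSet_Ioi heq, integral_Ioi_rpow_of_lt (by norm_num) hc]
  norm_num [Real.rpow_neg_one]

/-- **Tail bound for the product `W·F`.**
If `W, F ≥ 0` are independent, `P(W ≥ t) ≤ μ/t` for all `t > 0`, and `F` has density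
`f(x) = 1/x²` for `x ≥ 1` (and `0` otherwise), then for every `c ≥ 1`,
`P(W·F ≥ cμ) ≤ (1 + ln c)/c`. -/
theorem tail_bound_product
    {Ω : Type*} [MeasureSpace Ω] [IsProbabilityMeasure (ℙ : Measure Ω)]
    (W F : Ω → ℝ) (hWm : Measurable W) (hFm : Measurable F)
    (hW0 : ∀ ω, 0 ≤ W ω) (hF0 : ∀ ω, 0 ≤ F ω)
    (hind : IndepFun W F ℙ)
    (μ : ℝ) (hμ : 0 < μ)
    (htail : ∀ t : ℝ, 0 < t → ℙ {ω | t ≤ W ω} ≤ ENNReal.ofReal (μ / t))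
    (hlaw : Measure.map F ℙ =
      (volume : Measure ℝ).withDensity
        (fun x => ENNReal.ofReal (if 1 ≤ x then 1 / x ^ 2 else 0)))
    (c : ℝ) (hc : 1 ≤ c) :
    ℙ {ω | c * μ ≤ W ω * F ω} ≤ ENNReal.ofReal ((1 + Real.log c) / c) := by
  have hc0 : 0 < c := by linarith
  have hS : MeasurableSet {p : ℝ × ℝ | c * μ ≤ p.1 * p.2} :=
    measurableSet_le measurable_const (measurable_fst.mul measurable_snd)
  have : IsProbabilityMeasure (Measure.map W ℙ) :=
    Measure.isProbabilityMeasure_map hWm.aemeasurable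
  have : IsProbabilityMeasure (Measure.map F ℙ) :=
    Measure.isProbabilityMeasure_map hFm.aemeasurable
  have hdens : Measurable fun x : ℝ => ENNReal.ofReal (if 1 ≤ x then 1 / x ^ 2 else 0) :=
    (Measurable.ite measurableSet_Ici (by fun_prop) measurable_const).ennreal_ofReal
  have hprod : ℙ {ω | c * μ ≤ W ω * F ω} =
      ∫⁻ y, Measure.map W ℙ {x | c * μ ≤ x * y} ∂(Measure.map F ℙ) := by
    change ℙ ((fun ω => (W ω, F ω)) ⁻¹' {p : ℝ × ℝ | c * μ ≤ p.1 * p.2}) = _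
    rw [← Measure.map_apply (hWm.prodMk hFm) hS,
      (indepFun_iff_map_prod_eq_prod_map_map hWm.aemeasurable hFm.aemeasurable).1 hind,
      Measure.prod_apply_symm hS]
    rfl
  have htail_map : ∀ y : ℝ, 0 < y →
      Measure.map W ℙ {x | c * μ ≤ x * y} ≤ ENNReal.ofReal (y / c) := by
    intro y hy
    have hset : {x : ℝ | c * μ ≤ x * y} = Set.Ici (c * μ / y) := by
      ext x
      simp [div_le_iff₀ hy]
    rw [hset, Measure.map_apply hWm measurableSet_Ici]
    have hdiv : y / c = μ / (c * μ / y) := by field_simp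
    rw [hdiv]
    exact htail (c * μ / y) (by positivity)
  have hmeas : Measurable fun y => Measure.map W ℙ {x | c * μ ≤ x * y} :=
    measurable_measure_prodMk_right hS
  rw [hprod, hlaw, lintegral_withDensity_eq_lintegral_mul₀ hdens.aemeasurable
    hmeas.aemeasurable, add_div, add_comm,
    ENNReal.ofReal_add (div_nonneg (Real.log_nonneg hc) hc0.le) (by positivity),
    ← lintegral_Icc_one_ofReal_inv_div hc, ← lintegral_Ioi_ofReal_one_div_sq hc0,
    ← lintegral_indicator measurableSet_Icc, ← lintegral_indicator measurableSet_Ioi,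
    ← lintegral_add_left (Measurable.indicator (by fun_prop) measurableSet_Icc)]
  refine lintegral_mono fun x => ?_
  rw [Pi.mul_apply]
  rcases lt_or_ge x 1 with hx | hx
  · simp [hx.not_ge]
  have hx0 : 0 < x := by linarith
  rw [if_pos hx]
  rcases le_or_gt x c with hxc | hxc
  · rw [Set.indicator_of_mem (show x ∈ Set.Icc 1 c from ⟨hx, hxc⟩)]
    refine le_add_right ((mul_le_mul_right (htail_map x hx0) _).trans_eq ?_)
    rw [← ENNReal.ofReal_mul (by positivity)]
    congr 1
    field_simp
  · rw [Set.indicator_of_mem (show x ∈ Set.Ioi c from hxc)]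
    exact le_add_left (mul_le_of_le_one_right' prob_le_one)
end

section
/- Let x, x′ ∈ ℝⁿ, let k ≥ 1, and let S (respectively S′) be a set of k indices containing the largest k coordinates of x (respectively x′) in magnitude, i.e., |x_i| ≥ |x_j| for all i ∈ S, j ∉ S, and |x′_i| ≥ |x′_j| for all i ∈ S′, j ∉ S′. Let Err₂(k, x) = min over k-sparse x̂ of ‖x̂ − x‖₂. If 0 ≤ ε ≤ 1 and ‖(x′ − x)_{S ∪ S′}‖₂ ≤ ε · Err₂(k, x), then ‖x′_{S′} − x‖₂ ≤ (1 + 3ε) · Err₂(k, x). -/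
/-- `err2 k x` is the minimal ℓ₂ distance from `x` to a `k`-sparse vector. -/
noncomputable def err2 {n : ℕ} (k : ℕ) (x : Fin n → ℝ) : ℝ :=
  sInf {e : ℝ | ∃ y : Fin n → ℝ,
    (Finset.univ.filter (fun i => y i ≠ 0)).card ≤ k ∧
    e = Real.sqrt (∑ i, (y i - x i) ^ 2)}

open Finset in
theorem sum_le_sum_of_card_le_of_forall_le {ι : Type*} {A B : Finset ι} {f : ι → ℝ}
    (hf : ∀ i, 0 ≤ f i) (hcard : A.card ≤ B.card) (h : ∀ a ∈ A, ∀ b ∈ B, f a ≤ f b) :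
    ∑ i ∈ A, f i ≤ ∑ i ∈ B, f i := by
  rcases A.eq_empty_or_nonempty with rfl | hA
  · simpa using sum_nonneg fun i _ => hf i
  obtain ⟨a, ha, hmax⟩ := A.exists_max_image f hA
  calc ∑ i ∈ A, f i ≤ A.card • f a := sum_le_card_nsmul A f (f a) hmax
    _ ≤ B.card • f a := nsmul_le_nsmul_left (hf a) hcard
    _ ≤ ∑ i ∈ B, f i := card_nsmul_le_sum B f (f a) (h a ha)

open Finset in
theorem sum_sdiff_le_sum_sdiff_of_top {ι : Type*} [DecidableEq ι] {S T : Finset ι} {f : ι → ℝ}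
    (hf : ∀ i, 0 ≤ f i) (hcard : T.card ≤ S.card) (h : ∀ i ∈ S, ∀ j ∉ S, f j ≤ f i) :
    ∑ i ∈ T \ S, f i ≤ ∑ i ∈ S \ T, f i := by
  refine sum_le_sum_of_card_le_of_forall_le hf ?_ fun a ha b hb =>
    h b (mem_sdiff.1 hb).1 a (mem_sdiff.1 ha).2
  have h₁ := card_sdiff_add_card_inter T S
  have h₂ := card_sdiff_add_card_inter S T
  rw [inter_comm] at h₂
  omega

theorem sqrt_sum_sq_le_add {ι : Type*} (A : Finset ι) (u v : ι → ℝ) :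
    √(∑ i ∈ A, u i ^ 2) ≤ √(∑ i ∈ A, v i ^ 2) + √(∑ i ∈ A, (u i - v i) ^ 2) := by
  have hcs := Real.sum_mul_le_sqrt_mul_sqrt A v fun i => u i - v i
  have hv : 0 ≤ ∑ i ∈ A, v i ^ 2 := Finset.sum_nonneg fun i _ => sq_nonneg _
  have hd : 0 ≤ ∑ i ∈ A, (u i - v i) ^ 2 := Finset.sum_nonneg fun i _ => sq_nonneg _
  refine Real.sqrt_le_iff.2 ⟨by positivity, ?_⟩
  have hu : ∑ i ∈ A, u i ^ 2 =
      ∑ i ∈ A, v i ^ 2 + 2 * ∑ i ∈ A, v i * (u i - v i) + ∑ i ∈ A, (u i - v i) ^ 2 := by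
    rw [Finset.mul_sum, ← Finset.sum_add_distrib, ← Finset.sum_add_distrib]
    exact Finset.sum_congr rfl fun i _ => by ring
  rw [add_sq, Real.sq_sqrt hv, Real.sq_sqrt hd]
  linarith

/-- The tail of `x` outside a set of its `k` largest coordinates is at most `err2 k x`. -/
theorem sqrt_sum_compl_le_err2 {n : ℕ} {x : Fin n → ℝ} {k : ℕ} {S : Finset (Fin n)}
    (hcard : S.card = k) (htop : ∀ i ∈ S, ∀ j ∉ S, |x j| ≤ |x i|) :
    √(∑ i ∈ Sᶜ, x i ^ 2) ≤ err2 k x := by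
  refine le_csInf ⟨_, 0, by simp, rfl⟩ ?_
  rintro _ ⟨y, hy, rfl⟩
  refine Real.sqrt_le_sqrt ?_
  set T := Finset.univ.filter fun i => y i ≠ 0 with hT
  have hsd := sum_sdiff_le_sum_sdiff_of_top (S := S) (T := T) (f := fun i => x i ^ 2)
    (fun i => sq_nonneg _) (hcard ▸ hy) fun i hi j hj => sq_le_sq.2 (htop i hi j hj)
  have h₁ := Finset.sum_inter_add_sum_sdiff S T fun i => x i ^ 2
  have h₂ := Finset.sum_inter_add_sum_sdiff T S fun i => x i ^ 2
  rw [Finset.inter_comm] at h₂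
  have h₃ := Finset.sum_add_sum_compl S fun i => x i ^ 2
  have h₄ := Finset.sum_add_sum_compl T fun i => x i ^ 2
  calc ∑ i ∈ Sᶜ, x i ^ 2 ≤ ∑ i ∈ Tᶜ, x i ^ 2 := by linarith
    _ = ∑ i ∈ Tᶜ, (y i - x i) ^ 2 := Finset.sum_congr rfl fun i hi => by
      have : y i = 0 := by simpa [hT] using hi
      simp [this]
    _ ≤ ∑ i, (y i - x i) ^ 2 :=
      Finset.sum_le_sum_of_subset_of_nonneg (Finset.subset_univ _) fun i _ _ => sq_nonneg _

/-- **ℓ₂ thresholding lemma.**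
If `S` (resp. `S'`) holds the largest `k` coordinates of `x` (resp. `x'`) in
magnitude, and `‖(x' - x)_{S ∪ S'}‖₂ ≤ ε · Err₂(k, x)` with `0 ≤ ε ≤ 1`, then
`‖x'_{S'} - x‖₂ ≤ (1 + 3ε) · Err₂(k, x)`. -/
theorem l2_thresholding
    {n : ℕ} (x x' : Fin n → ℝ) (k : ℕ) (hk : 1 ≤ k)
    (S S' : Finset (Fin n)) (hScard : S.card = k) (hS'card : S'.card = k)
    (hStop : ∀ i ∈ S, ∀ j ∉ S, |x j| ≤ |x i|)
    (hS'top : ∀ i ∈ S', ∀ j ∉ S', |x' j| ≤ |x' i|)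
    (ε : ℝ) (hε0 : 0 ≤ ε) (hε1 : ε ≤ 1)
    (hbound : Real.sqrt (∑ i ∈ S ∪ S', (x' i - x i) ^ 2) ≤ ε * err2 k x) :
    Real.sqrt (∑ i, ((if i ∈ S' then x' i else 0) - x i) ^ 2) ≤
      (1 + 3 * ε) * err2 k x := by
  set e := err2 k x
  have htail : √(∑ i ∈ Sᶜ, x i ^ 2) ≤ e := sqrt_sum_compl_le_err2 hScard hStop
  have he : 0 ≤ e := (Real.sqrt_nonneg _).trans htail
  have hd : ∀ A ⊆ S ∪ S', √(∑ i ∈ A, (x' i - x i) ^ 2) ≤ ε * e := fun A hA =>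
    (Real.sqrt_le_sqrt (Finset.sum_le_sum_of_subset_of_nonneg hA fun i _ _ => sq_nonneg _)).trans
      hbound
  have hdA := hd (S \ S') (Finset.sdiff_subset.trans Finset.subset_union_left)
  have hdB := hd (S' \ S) (Finset.sdiff_subset.trans Finset.subset_union_right)
  have hdS' := (Real.sqrt_le_iff.1 (hd S' Finset.subset_union_right)).2
  have hA := sqrt_sum_sq_le_add (S \ S') x x'
  have hB := sqrt_sum_sq_le_add (S' \ S) x' x
  simp only [sub_sq_comm (x _) (x' _)] at hA
  have hswap : √(∑ i ∈ S \ S', x' i ^ 2) ≤ √(∑ i ∈ S' \ S, x' i ^ 2) :=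
    Real.sqrt_le_sqrt <| sum_sdiff_le_sum_sdiff_of_top (f := fun i => x' i ^ 2)
      (fun i => sq_nonneg _) (by omega) fun i hi j hj => sq_le_sq.2 (hS'top i hi j hj)
  have hBS : √(∑ i ∈ S' \ S, x i ^ 2) ≤ e :=
    (Real.sqrt_le_sqrt (Finset.sum_le_sum_of_subset_of_nonneg (fun i hi => by
      simp_all) fun i _ _ => sq_nonneg _)).trans htail
  have hAB : √(∑ i ∈ S \ S', x i ^ 2) ≤ √(∑ i ∈ S' \ S, x i ^ 2) + 2 * (ε * e) := by linarith
  have hAB' := (Real.sqrt_le_iff.1 hAB).2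
  have hB0 : 0 ≤ ∑ i ∈ S' \ S, x i ^ 2 := Finset.sum_nonneg fun i _ => sq_nonneg _
  rw [add_sq, Real.sq_sqrt hB0] at hAB'
  have htail' := (Real.sqrt_le_iff.1 htail).2
  have hεe : 0 ≤ ε * e := mul_nonneg hε0 he
  have hcross := mul_le_mul_of_nonneg_right hBS hεe
  have hsplit : ∑ i, ((if i ∈ S' then x' i else 0) - x i) ^ 2 =
      ∑ i ∈ S', (x' i - x i) ^ 2 + ∑ i ∈ S'ᶜ, x i ^ 2 := by
    rw [← Finset.sum_add_sum_compl S']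
    congr 1 <;> refine Finset.sum_congr rfl fun i hi => ?_
    · simp [hi]
    · simp [Finset.mem_compl.1 hi]
  have h₁ := Finset.sum_inter_add_sum_sdiff S S' fun i => x i ^ 2
  have h₂ := Finset.sum_inter_add_sum_sdiff S' S fun i => x i ^ 2
  rw [Finset.inter_comm] at h₂
  have h₃ := Finset.sum_add_sum_compl S fun i => x i ^ 2
  have h₄ := Finset.sum_add_sum_compl S' fun i => x i ^ 2
  refine Real.sqrt_le_iff.2 ⟨by positivity, ?_⟩
  rw [hsplit]
  nlinarith [mul_nonneg hεe he, sq_nonneg (ε * e)]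
end

section
/- Let x, x′ ∈ ℝⁿ, let k ≥ 1, and let S′ be a set of k indices containing the largest k coordinates of x′ in magnitude, i.e., |x′_i| ≥ |x′_j| for all i ∈ S′, j ∉ S′. Let Err₂(k, x) = min over k-sparse x̂ of ‖x̂ − x‖₂. If 0 ≤ ε ≤ 1 and ‖x′ − x‖_∞ ≤ (ε/√(2k)) · Err₂(k, x), then ‖x′_{S′} − x‖₂ ≤ (1 + 3ε) · Err₂(k, x). -/
/-- If `|v|` on `A` dominates `|v|` on `D` up to a threshold, and `#D ≤ #A`, then the energy of
any `δ`-perturbation `x` of `v` on `D` is controlled by that on `A`. -/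
theorem sum_sq_le_sum_sq_of_threshold {ι : Type*} {A D : Finset ι} (hcard : D.card ≤ A.card)
    {x v : ι → ℝ} {τ δ : ℝ} (hτ : 0 ≤ τ) (hδ : 0 ≤ δ) (hvx : ∀ i, |v i - x i| ≤ δ)
    (hD : ∀ j ∈ D, |v j| ≤ τ) (hA : ∀ i ∈ A, τ ≤ |v i|) :
    ∑ j ∈ D, x j ^ 2 ≤ ∑ i ∈ A, (|x i| + 2 * δ) ^ 2 := by
  have hxv (i : ι) : |x i| ≤ |v i| + δ := by
    have := abs_sub_abs_le_abs_sub (x i) (v i)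
    rw [abs_sub_comm] at this
    linarith [hvx i]
  have hvx' (i : ι) : |v i| ≤ |x i| + δ := by
    linarith [abs_sub_abs_le_abs_sub (v i) (x i), hvx i]
  calc ∑ j ∈ D, x j ^ 2 ≤ D.card • (τ + δ) ^ 2 := by
        refine Finset.sum_le_card_nsmul _ _ _ fun j hj => ?_
        rw [← sq_abs (x j)]
        have := hxv j
        have := hD j hj
        gcongr
        linarith
    _ ≤ A.card • (τ + δ) ^ 2 := by gcongr
    _ ≤ ∑ i ∈ A, (|x i| + 2 * δ) ^ 2 := by
        refine Finset.card_nsmul_le_sum _ _ _ fun i hi => ?_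
        have := hvx' i
        have := hA i hi
        gcongr ?_ ^ 2
        linarith

theorem err2_nonneg {n : ℕ} (k : ℕ) (x : Fin n → ℝ) : 0 ≤ err2 k x := by
  refine Real.sInf_nonneg ?_
  rintro _ ⟨y, -, rfl⟩
  exact Real.sqrt_nonneg _

theorem err2_le {n k : ℕ} {x y : Fin n → ℝ}
    (hy : (Finset.univ.filter (fun i => y i ≠ 0)).card ≤ k) :
    err2 k x ≤ Real.sqrt (∑ i, (y i - x i) ^ 2) := by
  refine csInf_le ⟨0, ?_⟩ ⟨y, hy, rfl⟩
  rintro _ ⟨z, -, rfl⟩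
  exact Real.sqrt_nonneg _

theorem le_err2 {n k : ℕ} {x : Fin n → ℝ} {b : ℝ}
    (h : ∀ y : Fin n → ℝ, (Finset.univ.filter (fun i => y i ≠ 0)).card ≤ k →
      b ≤ Real.sqrt (∑ i, (y i - x i) ^ 2)) : b ≤ err2 k x := by
  refine le_csInf ⟨_, 0, by simp, rfl⟩ ?_
  rintro _ ⟨y, hy, rfl⟩
  exact h y hy

/-- **ℓ∞ thresholding corollary.**
If `S'` holds the largest `k` coordinates of `x'` in magnitude and
`‖x' - x‖_∞ ≤ (ε/√(2k)) · Err₂(k, x)` with `0 ≤ ε ≤ 1`, then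
`‖x'_{S'} - x‖₂ ≤ (1 + 3ε) · Err₂(k, x)`. -/
theorem linf_thresholding
    {n : ℕ} (x x' : Fin n → ℝ) (k : ℕ) (hk : 1 ≤ k)
    (S' : Finset (Fin n)) (hS'card : S'.card = k)
    (hS'top : ∀ i ∈ S', ∀ j ∉ S', |x' j| ≤ |x' i|)
    (ε : ℝ) (hε0 : 0 ≤ ε) (hε1 : ε ≤ 1)
    (hbound : ∀ i, |x' i - x i| ≤ ε / Real.sqrt (2 * k) * err2 k x) :
    Real.sqrt (∑ i, ((if i ∈ S' then x' i else 0) - x i) ^ 2) ≤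
      (1 + 3 * ε) * err2 k x := by
  have hE := err2_nonneg k x
  have hk0 : (0 : ℝ) < k := by exact_mod_cast hk
  obtain ⟨c, hc0, hc, hkc⟩ : ∃ c : ℝ, 0 ≤ c ∧ (∀ i, |x' i - x i| ≤ ε * c) ∧
      k * c ^ 2 = err2 k x ^ 2 / 2 := by
    refine ⟨err2 k x / Real.sqrt (2 * k), by positivity, fun i => ?_, ?_⟩
    · exact (hbound i).trans_eq (by ring)
    · rw [div_pow, Real.sq_sqrt (by positivity)]
      field_simp
  obtain ⟨τ, hτ0, hτS, hτ⟩ : ∃ τ : ℝ, 0 ≤ τ ∧ (∀ i ∈ S', τ ≤ |x' i|) ∧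
      ∀ j ∉ S', |x' j| ≤ τ := by
    have hne : S'.Nonempty := Finset.card_pos.mp (by omega)
    obtain ⟨i, hi, hmin⟩ := S'.exists_min_image (fun i => |x' i|) hne
    exact ⟨|x' i|, abs_nonneg _, hmin, hS'top i hi⟩
  rw [mul_comm, ← div_le_iff₀ (by positivity)]
  refine le_err2 fun y hy => ?_
  rw [div_le_iff₀ (by positivity)]
  have hEM := err2_le (x := x) hy
  set M := Real.sqrt (∑ i, (y i - x i) ^ 2) with hM
  have hMsq : M ^ 2 = ∑ i, (y i - x i) ^ 2 := Real.sq_sqrt (by positivity)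
  have hM0 : 0 ≤ M := Real.sqrt_nonneg _
  have hkM : k * c ^ 2 ≤ M ^ 2 / 2 := by
    rw [hkc]
    gcongr
  set T := Finset.univ.filter (fun i => y i ≠ 0) with hT
  have hcard : (T \ S').card ≤ (S' \ T).card := by
    have h₁ := Finset.card_sdiff_add_card_inter T S'
    have h₂ := Finset.card_sdiff_add_card_inter S' T
    rw [Finset.inter_comm] at h₂
    omega
  have hswap := sum_sq_le_sum_sq_of_threshold hcard hτ0 (by positivity) hc
    (fun j hj => hτ j (Finset.mem_sdiff.mp hj).2) (fun i hi => hτS i (Finset.mem_sdiff.mp hi).1)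
  have hexpand : ∑ i ∈ S' \ T, (|x i| + 2 * (ε * c)) ^ 2 ≤
      (1 + ε) * ∑ i ∈ S' \ T, x i ^ 2 + k * (4 * (ε + ε ^ 2) * c ^ 2) := by
    calc ∑ i ∈ S' \ T, (|x i| + 2 * (ε * c)) ^ 2
        ≤ ∑ i ∈ S' \ T, ((1 + ε) * x i ^ 2 + 4 * (ε + ε ^ 2) * c ^ 2) := by
          refine Finset.sum_le_sum fun i _ => ?_
          rw [← sq_abs (x i)]
          nlinarith [mul_nonneg hε0 (sq_nonneg (|x i| - 2 * c))]
      _ = (1 + ε) * ∑ i ∈ S' \ T, x i ^ 2 + (S' \ T).card * (4 * (ε + ε ^ 2) * c ^ 2) := by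
          rw [Finset.sum_add_distrib, Finset.mul_sum, Finset.sum_const, nsmul_eq_mul]
      _ ≤ _ := by
          gcongr
          exact (Finset.card_le_card Finset.sdiff_subset).trans hS'card.le
  have hhead : ∑ i ∈ S', (x' i - x i) ^ 2 ≤ k * (ε * c) ^ 2 := by
    rw [← hS'card, ← nsmul_eq_mul]
    refine Finset.sum_le_card_nsmul _ _ _ fun i _ => ?_
    rw [← sq_abs (x' i - x i)]
    have := hc i
    gcongr
  have hsplit : ∑ i, ((if i ∈ S' then x' i else 0) - x i) ^ 2 =
      ∑ i ∈ S', (x' i - x i) ^ 2 + (∑ i ∈ T \ S', x i ^ 2 + ∑ i ∈ (S' ∪ T)ᶜ, x i ^ 2) := by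
    have hite (U : Finset (Fin n)) (f : Fin n → ℝ) :
        ∑ i ∈ U, f i = ∑ i, if i ∈ U then f i else 0 := by simp
    rw [hite S', hite (T \ S'), hite (S' ∪ T)ᶜ, ← Finset.sum_add_distrib,
      ← Finset.sum_add_distrib]
    refine Finset.sum_congr rfl fun i _ => ?_
    by_cases h₁ : i ∈ S' <;> by_cases h₂ : i ∈ T <;> simp [h₁, h₂]
  have htail : ∑ i ∈ S' \ T, x i ^ 2 + ∑ i ∈ (S' ∪ T)ᶜ, x i ^ 2 ≤ M ^ 2 := by
    have hdisj : Disjoint (S' \ T) (S' ∪ T)ᶜ :=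
      disjoint_compl_right.mono_left (Finset.sdiff_subset.trans Finset.subset_union_left)
    rw [hMsq, ← Finset.sum_union hdisj]
    calc ∑ i ∈ S' \ T ∪ (S' ∪ T)ᶜ, x i ^ 2
        = ∑ i ∈ S' \ T ∪ (S' ∪ T)ᶜ, (y i - x i) ^ 2 := by
          refine Finset.sum_congr rfl fun i hi => ?_
          have hy0 : y i = 0 := by
            by_contra h
            simp [hT, h] at hi
          simp [hy0]
      _ ≤ _ := Finset.sum_le_univ_sum_of_nonneg fun i => sq_nonneg _
  have hA0 : 0 ≤ ∑ i ∈ (S' ∪ T)ᶜ, x i ^ 2 := by positivity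
  refine Real.sqrt_le_iff.mpr ⟨by positivity, ?_⟩
  rw [hsplit]
  have h₁ := mul_le_mul_of_nonneg_left hkM (by positivity : 0 ≤ 4 * (ε + ε ^ 2) + ε ^ 2)
  have h₂ := mul_nonneg hε0 hA0
  have h₃ := mul_le_mul_of_nonneg_left htail hε0
  nlinarith [mul_nonneg hε0 (sq_nonneg M), mul_nonneg (sq_nonneg ε) (sq_nonneg M)]
end

section
/- Let a, b, a′, b′ ∈ ℝ^d satisfy a_i ≥ b_i and b′_i ≥ a′_i for every coordinate i. Let E > 0 and 0 ≤ ε ≤ 1, and suppose ‖a − a′‖₂² + ‖b − b′‖₂² ≤ ε² E² and ‖b‖₂ ≤ E. Then ‖a − b‖₂ ≤ √2 · ε E, and consequently ‖a‖₂² − ‖b‖₂² ≤ 5 ε E². (This is the key intermediate claim in the proof of the paper's ℓ₂ thresholding lemma: the mass of the true top-k coordinates missed by the recovered support exceeds the mass of the substituted coordinates by at most 5εE², where E = Err₂(k, x).) -/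
/-- **Key intermediate claim of the ℓ₂ thresholding lemma.**
If `a ≥ b` and `b' ≥ a'` coordinatewise, `‖a - a'‖₂² + ‖b - b'‖₂² ≤ ε²E²`, and
`‖b‖₂ ≤ E`, then `‖a - b‖₂ ≤ √2 · εE`, and consequently
`‖a‖₂² - ‖b‖₂² ≤ 5εE²`. -/
theorem thresholding_mass_swap
    {d : ℕ} (a b a' b' : Fin d → ℝ)
    (hab : ∀ i, b i ≤ a i) (ha'b' : ∀ i, a' i ≤ b' i)
    (E ε : ℝ) (hE : 0 < E) (hε0 : 0 ≤ ε) (hε1 : ε ≤ 1)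
    (hclose : (∑ i, (a i - a' i) ^ 2) + (∑ i, (b i - b' i) ^ 2) ≤ ε ^ 2 * E ^ 2)
    (hbE : Real.sqrt (∑ i, (b i) ^ 2) ≤ E) :
    Real.sqrt (∑ i, (a i - b i) ^ 2) ≤ Real.sqrt 2 * ε * E ∧
    (∑ i, (a i) ^ 2) - (∑ i, (b i) ^ 2) ≤ 5 * ε * E ^ 2 := by
  have hεE : 0 ≤ ε * E := by positivity
  have hsum : ∑ i, (a i - b i) ^ 2 ≤ 2 * (ε * E) ^ 2 := by
    calc ∑ i, (a i - b i) ^ 2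
        ≤ ∑ i, 2 * ((a i - a' i) ^ 2 + (b i - b' i) ^ 2) := by
          refine Finset.sum_le_sum fun i _ => ?_
          have h : (a i - b i) ^ 2 ≤ ((a i - a' i) - (b i - b' i)) ^ 2 :=
            pow_le_pow_left₀ (sub_nonneg.2 (hab i)) (by linarith [ha'b' i]) 2
          nlinarith [sq_nonneg ((a i - a' i) + (b i - b' i))]
      _ = 2 * ((∑ i, (a i - a' i) ^ 2) + ∑ i, (b i - b' i) ^ 2) := by
          rw [← Finset.mul_sum, Finset.sum_add_distrib]
      _ ≤ 2 * (ε * E) ^ 2 := by rw [mul_pow]; linarith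
  have hnorm : Real.sqrt (∑ i, (a i - b i) ^ 2) ≤ Real.sqrt 2 * ε * E := by
    refine (Real.sqrt_le_sqrt hsum).trans_eq ?_
    rw [Real.sqrt_mul zero_le_two, Real.sqrt_sq hεE, mul_assoc]
  refine ⟨hnorm, ?_⟩
  have hinner : ∑ i, b i * (a i - b i) ≤ E * (Real.sqrt 2 * ε * E) :=
    (Real.sum_mul_le_sqrt_mul_sqrt _ _ _).trans
      (mul_le_mul hbE hnorm (Real.sqrt_nonneg _) hE.le)
  have hexpand : (∑ i, (a i) ^ 2) - (∑ i, (b i) ^ 2)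
      = ∑ i, (a i - b i) ^ 2 + 2 * ∑ i, b i * (a i - b i) := by
    rw [Finset.mul_sum, ← Finset.sum_add_distrib, ← Finset.sum_sub_distrib]
    exact Finset.sum_congr rfl fun i _ => by ring
  have hsqrt : Real.sqrt 2 ≤ 3 / 2 := Real.sqrt_le_iff.2 (by norm_num)
  have hεE2 : 0 ≤ ε * E ^ 2 := by positivity
  calc (∑ i, (a i) ^ 2) - (∑ i, (b i) ^ 2)
      ≤ 2 * (ε * E) ^ 2 + 2 * (E * (Real.sqrt 2 * ε * E)) := by rw [hexpand]; linarith
    _ = (2 * ε + 2 * Real.sqrt 2) * (ε * E ^ 2) := by ring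
    _ ≤ 5 * (ε * E ^ 2) := mul_le_mul_of_nonneg_right (by linarith) hεE2
    _ = 5 * ε * E ^ 2 := by ring
end

section
/- Let x, x′ ∈ ℝⁿ, k ≥ 1 with 9k ≤ n, and δ ≥ 0 with |x′_i − x_i| ≤ δ for all i. Let S be a set of k indices with |x_i| ≥ |x_j| for all i ∈ S, j ∉ S, and set t = min_{i ∈ S} |x_i|. Let R be a set of 9k indices with |x_i| ≥ |x_j| for all i ∈ R, j ∉ R. Suppose δ < t/3 and |x_j| ≤ t/3 for all j ∉ R. Then |x′_i| > |x′_j| for every i ∈ S and every j ∉ R; consequently, S ⊆ R′ for every set R′ of 9k indices satisfying |x′_a| ≥ |x′_b| for all a ∈ R′, b ∉ R′. (This is the deterministic core of the paper's lemma that Count-Sketch estimates identify a candidate support containing the top k coordinates of a sub-Zipfian vector.) -/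
/-- **Deterministic core of sub-Zipfian support identification.**
If every coordinate estimate is accurate to within `δ < t/3`, where `t` is the `k`-th
largest magnitude of `x`, and all coordinates outside a top-`9k` set `R` have
magnitude at most `t/3`, then every top-`k` coordinate of `x` is estimated strictly
larger than every coordinate outside `R`; consequently the top-`k` set `S` is
contained in any top-`9k` set of the estimates. -/
theorem subzipfian_support_identification
    {n : ℕ} (x x' : Fin n → ℝ) (k : ℕ) (hk : 1 ≤ k) (h9k : 9 * k ≤ n)
    (δ : ℝ) (hδ0 : 0 ≤ δ) (herr : ∀ i, |x' i - x i| ≤ δ)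
    (S : Finset (Fin n)) (hScard : S.card = k)
    (hStop : ∀ i ∈ S, ∀ j ∉ S, |x j| ≤ |x i|)
    (t : ℝ) (htle : ∀ i ∈ S, t ≤ |x i|) (htmem : ∃ i ∈ S, |x i| = t)
    (R : Finset (Fin n)) (hRcard : R.card = 9 * k)
    (hRtop : ∀ i ∈ R, ∀ j ∉ R, |x j| ≤ |x i|)
    (hδt : δ < t / 3) (htail : ∀ j ∉ R, |x j| ≤ t / 3) :
    (∀ i ∈ S, ∀ j ∉ R, |x' j| < |x' i|) ∧
    ∀ R' : Finset (Fin n), R'.card = 9 * k →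
      (∀ a ∈ R', ∀ b ∉ R', |x' b| ≤ |x' a|) → S ⊆ R' := by
  have hlt : ∀ i ∈ S, ∀ j ∉ R, |x' j| < |x' i| := by
    intro i hi j hj
    have hlow : |x i| - |x' i| ≤ δ :=
      (abs_sub_abs_le_abs_sub _ _).trans (abs_sub_comm (x i) (x' i) ▸ herr i)
    have hup : |x' j| - |x j| ≤ δ := (abs_sub_abs_le_abs_sub _ _).trans (herr j)
    linarith [htle i hi, htail j hj]
  refine ⟨hlt, fun R' hR'card hR'top i hi => ?_⟩
  by_contra hiR'
  have hsub : R' ⊆ R := fun a ha => by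
    by_contra haR
    exact (hlt i hi a haR).not_ge (hR'top a ha i hiR')
  have heq : R' = R := Finset.eq_of_subset_of_card_le hsub (by omega)
  exact lt_irrefl _ (hlt i hi i (heq ▸ hiR'))
end

section
/- Let m, n ≥ 1, let x, x¹, …, x^m ∈ ℝⁿ, let μ ≥ 0, and let J ⊆ {1, …, m} with |J| ≥ 3m/4 and ‖x^j − x‖₂ ≤ μ for every j ∈ J. Let y ∈ ℝⁿ be a coordinatewise median of x¹, …, x^m, i.e., for every coordinate i, |{j ∈ [m] : (x^j)_i ≤ y_i}| ≥ m/2 and |{j ∈ [m] : (x^j)_i ≥ y_i}| ≥ m/2. Then ‖y − x‖₂ ≤ √3 · μ. (This is the deterministic core of the paper's parallel-repetition argument for amplifying the success probability of the set query algorithm.) -/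
/-- A set containing at least half of the indices meets a set `J` containing at least three
quarters of them in at least a third of `J`. -/
theorem card_div_three_le_card_inter {ι : Type*} [Fintype ι] [DecidableEq ι] {A J : Finset ι}
    (hA : (Fintype.card ι : ℝ) / 2 ≤ A.card) (hJ : (3 * Fintype.card ι : ℝ) / 4 ≤ J.card) :
    (J.card : ℝ) / 3 ≤ (A ∩ J).card := by
  have h_add : ((A ∪ J).card : ℝ) + (A ∩ J).card = A.card + J.card := by
    exact_mod_cast Finset.card_union_add_card_inter A J
  have h_union : ((A ∪ J).card : ℝ) ≤ Fintype.card ι := by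
    exact_mod_cast Finset.card_le_univ (A ∪ J)
  linarith

/-- If `b` is a median of the reals `a j`, and `J` contains at least three quarters of the indices,
then `(b - c) ^ 2` is at most three times the average of `(a j - c) ^ 2` over `J`. -/
theorem card_mul_sq_median_sub_le {ι : Type*} [Fintype ι] {J : Finset ι}
    (hJ : (3 * Fintype.card ι : ℝ) / 4 ≤ J.card) (a : ι → ℝ) (b c : ℝ)
    (h_le : (Fintype.card ι : ℝ) / 2 ≤ ((Finset.univ.filter (fun j => a j ≤ b)).card : ℝ))
    (h_ge : (Fintype.card ι : ℝ) / 2 ≤ ((Finset.univ.filter (fun j => b ≤ a j)).card : ℝ)) :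
    (J.card : ℝ) * (b - c) ^ 2 ≤ 3 * ∑ j ∈ J, (a j - c) ^ 2 := by
  classical
  obtain ⟨A, hA, h_far⟩ : ∃ A : Finset ι, (Fintype.card ι : ℝ) / 2 ≤ A.card ∧
      ∀ j ∈ A, (b - c) ^ 2 ≤ (a j - c) ^ 2 := by
    rcases le_total c b with hcb | hbc
    · refine ⟨_, h_ge, fun j hj => ?_⟩
      have hj' : b ≤ a j := by simpa using hj
      nlinarith
    · refine ⟨_, h_le, fun j hj => ?_⟩
      have hj' : a j ≤ b := by simpa using hj
      nlinarith
  have h_inter : ((A ∩ J).card : ℝ) * (b - c) ^ 2 ≤ ∑ j ∈ A ∩ J, (a j - c) ^ 2 := by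
    simpa using Finset.card_nsmul_le_sum (A ∩ J) (fun j => (a j - c) ^ 2) ((b - c) ^ 2)
      fun j hj => h_far j (Finset.mem_inter.mp hj).1
  have h_sub : ∑ j ∈ A ∩ J, (a j - c) ^ 2 ≤ ∑ j ∈ J, (a j - c) ^ 2 :=
    Finset.sum_le_sum_of_subset_of_nonneg Finset.inter_subset_right fun _ _ _ => sq_nonneg _
  have h_card := mul_le_mul_of_nonneg_right (card_div_three_le_card_inter hA hJ)
    (sq_nonneg (b - c))
  linarith

/-- **Deterministic core of the parallel repetition argument.**
If at least `3m/4` of the vectors `x¹, …, xᵐ` are within ℓ₂ distance `μ` of `x`,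
then any coordinatewise median `y` of `x¹, …, xᵐ` satisfies `‖y - x‖₂ ≤ √3 · μ`. -/
theorem parallel_repetition_median
    {m n : ℕ} (hm : 1 ≤ m) (hn : 1 ≤ n)
    (x : Fin n → ℝ) (xs : Fin m → Fin n → ℝ) (μ : ℝ) (hμ : 0 ≤ μ)
    (J : Finset (Fin m)) (hJ : (3 * m : ℝ) / 4 ≤ J.card)
    (hgood : ∀ j ∈ J, Real.sqrt (∑ i, (xs j i - x i) ^ 2) ≤ μ)
    (y : Fin n → ℝ)
    (hmed_le : ∀ i, (m : ℝ) / 2 ≤ ((Finset.univ.filter (fun j => xs j i ≤ y i)).card : ℝ))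
    (hmed_ge : ∀ i, (m : ℝ) / 2 ≤ ((Finset.univ.filter (fun j => y i ≤ xs j i)).card : ℝ)) :
    Real.sqrt (∑ i, (y i - x i) ^ 2) ≤ Real.sqrt 3 * μ := by
  have hJ_pos : (0 : ℝ) < J.card := by
    have hm' : (1 : ℝ) ≤ m := by exact_mod_cast hm
    linarith
  have h_coord (i : Fin n) :
      (J.card : ℝ) * (y i - x i) ^ 2 ≤ 3 * ∑ j ∈ J, (xs j i - x i) ^ 2 :=
    card_mul_sq_median_sub_le (by simpa using hJ) (fun j => xs j i) (y i) (x i)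
      (by simpa using hmed_le i) (by simpa using hmed_ge i)
  have h_good : ∑ j ∈ J, ∑ i, (xs j i - x i) ^ 2 ≤ J.card * μ ^ 2 := by
    simpa using Finset.sum_le_card_nsmul J (fun j => ∑ i, (xs j i - x i) ^ 2) (μ ^ 2)
      fun j hj => (Real.sqrt_le_left hμ).mp (hgood j hj)
  have h_sum : (J.card : ℝ) * ∑ i, (y i - x i) ^ 2 ≤ J.card * (3 * μ ^ 2) := by
    calc (J.card : ℝ) * ∑ i, (y i - x i) ^ 2
        = ∑ i, (J.card : ℝ) * (y i - x i) ^ 2 := Finset.mul_sum _ _ _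
      _ ≤ ∑ i, 3 * ∑ j ∈ J, (xs j i - x i) ^ 2 := Finset.sum_le_sum fun i _ => h_coord i
      _ = 3 * ∑ j ∈ J, ∑ i, (xs j i - x i) ^ 2 := by rw [← Finset.mul_sum, Finset.sum_comm]
      _ ≤ J.card * (3 * μ ^ 2) := by linarith
  calc Real.sqrt (∑ i, (y i - x i) ^ 2)
      ≤ Real.sqrt (3 * μ ^ 2) := Real.sqrt_le_sqrt (le_of_mul_le_mul_left h_sum hJ_pos)
    _ = Real.sqrt 3 * μ := by rw [Real.sqrt_mul (by norm_num), Real.sqrt_sq hμ]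
end

section
/- There exists a universal constant C > 0 such that the following holds. Let t ≥ s ≥ 1 be integers, let w ∈ ℝ^t have nonnegative entries, and let z ∈ ℝ^t. Let U be a set of s indices with w_i ≥ w_j for all i ∈ U, j ∉ U, and set μ = (Σ_{j ∉ U} w_j²)^{1/2}. Suppose 0 < ε ≤ 1/2 and |w_i − z_i| ≤ ε w_i + (ε/√s) μ for every i. Let Û be any set of s indices with z_i ≥ z_j for all i ∈ Û, j ∉ Û. Then Σ_{j ∉ Û} w_j² ≤ (1 + Cε) μ². (This is the deterministic selection argument in the paper's block heavy hitters lemma: selecting the s blocks with largest estimated norms loses at most a (1 + O(ε)) factor in residual ℓ₂² mass.) -/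
/-- If an index with value `a` is ranked by its estimate `p` no higher than one with value `b` and
estimate `q`, where both estimates have relative error `ε` and additive error `ε * r`, then `a ^ 2`
exceeds `b ^ 2` by at most `O(ε) * (b ^ 2 + r ^ 2)`. -/
theorem sq_le_of_approx_le {a b p q r ε : ℝ} (ha : 0 ≤ a) (hb : 0 ≤ b) (hr : 0 ≤ r)
    (hε : 0 < ε) (hε' : ε ≤ 1 / 2) (hap : |a - p| ≤ ε * a + ε * r)
    (hbq : |b - q| ≤ ε * b + ε * r) (hpq : p ≤ q) :
    a ^ 2 ≤ b ^ 2 + (28 * ε * b ^ 2 + 20 * ε * r ^ 2) := by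
  have h₁ := (abs_le.mp hap).2
  have h₂ := (abs_le.mp hbq).1
  have hab : a ≤ (1 + 4 * ε) * b + 4 * ε * r := by
    have hb' : 0 ≤ ε * b * (1 - 2 * ε) := by
      have : 0 ≤ 1 - 2 * ε := by linarith
      positivity
    have hr' : 0 ≤ ε * r * (1 - 2 * ε) := by
      have : 0 ≤ 1 - 2 * ε := by linarith
      positivity
    have : 0 ≤ (1 - ε) * ((1 + 4 * ε) * b + 4 * ε * r - a) := by linarith
    linarith [nonneg_of_mul_nonneg_right this (by linarith)]
  have hε₂ : ε ^ 2 ≤ ε / 2 := by nlinarith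
  have hbr : 2 * (b * r) ≤ b ^ 2 + r ^ 2 := by nlinarith [sq_nonneg (b - r)]
  calc a ^ 2 ≤ ((1 + 4 * ε) * b + 4 * ε * r) ^ 2 := by gcongr
    _ = b ^ 2 + 8 * ε * b ^ 2 + 8 * ε * (b * r) +
        ε ^ 2 * (16 * b ^ 2 + 32 * (b * r) + 16 * r ^ 2) := by
      ring
    _ ≤ b ^ 2 + 8 * ε * b ^ 2 + 8 * ε * (b * r) +
        ε / 2 * (16 * b ^ 2 + 32 * (b * r) + 16 * r ^ 2) := by
      gcongr
    _ = b ^ 2 + 16 * ε * b ^ 2 + 12 * ε * (2 * (b * r)) + 8 * ε * r ^ 2 := by ring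
    _ ≤ b ^ 2 + 16 * ε * b ^ 2 + 12 * ε * (b ^ 2 + r ^ 2) + 8 * ε * r ^ 2 := by gcongr
    _ = b ^ 2 + (28 * ε * b ^ 2 + 20 * ε * r ^ 2) := by ring

/-- Pairwise domination between two finsets of equal cardinality passes to sums. -/
theorem Finset.sum_le_sum_of_card_eq {ι : Type*} {A B : Finset ι} {f g : ι → ℝ}
    (hcard : A.card = B.card) (h : ∀ i ∈ A, ∀ j ∈ B, f i ≤ g j) :
    ∑ i ∈ A, f i ≤ ∑ j ∈ B, g j := by
  let e := Finset.equivOfCardEq hcard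
  rw [← Finset.sum_coe_sort A, ← Finset.sum_coe_sort B, ← e.sum_comp]
  exact Finset.sum_le_sum fun i _ => h i i.2 (e i) (e i).2


/-- **Deterministic selection argument of the block heavy hitters lemma.**
There is a universal constant `C > 0` such that: if `w` is a nonnegative vector
whose top-`s` set is `U`, `μ² = ∑_{j ∉ U} w_j²`, and the estimates `z` satisfy
`|w_i - z_i| ≤ ε w_i + (ε/√s) μ` for all `i` with `0 < ε ≤ 1/2`, then any set `Û`
of `s` indices maximizing `z` satisfies `∑_{j ∉ Û} w_j² ≤ (1 + Cε) μ²`. -/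
theorem block_heavy_hitters_selection :
    ∃ C : ℝ, 0 < C ∧
      ∀ (t s : ℕ), 1 ≤ s → s ≤ t →
      ∀ (w z : Fin t → ℝ), (∀ i, 0 ≤ w i) →
      ∀ (U : Finset (Fin t)), U.card = s →
      (∀ i ∈ U, ∀ j ∉ U, w j ≤ w i) →
      ∀ ε : ℝ, 0 < ε → ε ≤ 1 / 2 →
      (∀ i, |w i - z i| ≤
        ε * w i + ε / Real.sqrt s * Real.sqrt (∑ j ∈ Uᶜ, (w j) ^ 2)) →
      ∀ Uhat : Finset (Fin t), Uhat.card = s →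
      (∀ i ∈ Uhat, ∀ j ∉ Uhat, z j ≤ z i) →
      ∑ j ∈ Uhatᶜ, (w j) ^ 2 ≤ (1 + C * ε) * ∑ j ∈ Uᶜ, (w j) ^ 2 := by
  refine ⟨48, by norm_num, ?_⟩
  intro t s hs _ w z hw U hU _ ε hε hε' hz V hV hVz
  set M := ∑ j ∈ Uᶜ, (w j) ^ 2
  have hM : 0 ≤ M := Finset.sum_nonneg fun j _ => sq_nonneg (w j)
  have hs₀ : (0 : ℝ) < s := by exact_mod_cast hs
  set r := Real.sqrt M / Real.sqrt s with hr
  have hr₀ : 0 ≤ r := by positivity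
  have hr₂ : s * r ^ 2 = M := by
    rw [hr, div_pow, Real.sq_sqrt hM, Real.sq_sqrt hs₀.le]
    field_simp
  have hz' : ∀ i, |w i - z i| ≤ ε * w i + ε * r := fun i =>
    (hz i).trans_eq (by rw [hr]; ring)
  have hswap : ∑ i ∈ U \ V, (w i) ^ 2 ≤
      ∑ j ∈ V \ U, ((w j) ^ 2 + (28 * ε * (w j) ^ 2 + 20 * ε * r ^ 2)) := by
    refine Finset.sum_le_sum_of_card_eq (Finset.card_sdiff_comm (hU.trans hV.symm)) ?_
    intro i hi j hj
    rw [Finset.mem_sdiff] at hi hj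
    exact sq_le_of_approx_le (hw i) (hw j) hr₀ hε hε' (hz' i) (hz' j) (hVz j hj.1 i hi.2)
  rw [Finset.sum_add_distrib, Finset.sum_add_distrib, ← Finset.mul_sum, Finset.sum_const,
    nsmul_eq_mul] at hswap
  have hmass : ∑ j ∈ V \ U, (w j) ^ 2 ≤ M := by
    refine Finset.sum_le_sum_of_subset_of_nonneg (fun j hj => ?_) fun j _ _ => sq_nonneg (w j)
    exact Finset.mem_compl.mpr (Finset.mem_sdiff.mp hj).2
  have hcard : ((V \ U).card : ℝ) ≤ s := by
    exact_mod_cast (Finset.card_le_card Finset.sdiff_subset).trans_eq hV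
  have htail : ((V \ U).card : ℝ) * (20 * ε * r ^ 2) ≤ 20 * ε * M := by
    calc ((V \ U).card : ℝ) * (20 * ε * r ^ 2) ≤ s * (20 * ε * r ^ 2) := by gcongr
      _ = 20 * ε * (s * r ^ 2) := by ring
      _ = 20 * ε * M := by rw [hr₂]
  have hhead : 28 * ε * ∑ j ∈ V \ U, (w j) ^ 2 ≤ 28 * ε * M := by gcongr
  have hUsum : ∑ j ∈ U, (w j) ^ 2 + M = ∑ j, (w j) ^ 2 := Finset.sum_add_sum_compl U _
  have hVsum := Finset.sum_add_sum_compl V fun j => (w j) ^ 2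
  have hdiff := Finset.sum_sdiff_sub_sum_sdiff (s₁ := V) (s₂ := U) (f := fun j => (w j) ^ 2)
  linarith
end

section
/- Let ι be a finite type and let R : ι → ι → Prop be a relation whose transitive closure is irreflexive (no cycles). Let T, Y : ι → ℝ satisfy |T_i| ≤ |Y_i| + Σ_{j : R j i} |T_j| for every i. Suppose every j satisfies |{i : R j i}| ≤ 2, and in every equivalence class of the reflexive-symmetric-transitive closure of R there is at most one element j with |{i : R j i}| = 2 (all other elements of the class having |{i : R j i}| ≤ 1). Then for every i, |T_i| ≤ 2 · Σ_{j in the equivalence class of i} |Y_j|. (This abstracts the paper's lemma bounding the deviation of the recovery output: |(x′ − x_S)_i| ≤ 2 Σ_{j ∈ S} |Y_j| C_{i,j}, where errors propagate along a directed acyclic graph in which each hyperedge has out-degree at most 1 except for at most one hyperedge per connected component with out-degree at most 2.) -/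
namespace PathCount

theorem wellFounded_swap_of_acyclic {ι : Type*} [Finite ι] {R : ι → ι → Prop}
    (hacyc : ∀ i, ¬ Relation.TransGen R i i) : WellFounded (fun k j => R j k) := by
  have : Std.Irrefl (fun k j => Relation.TransGen R j k) := ⟨hacyc⟩
  have : IsTrans ι (fun k j => Relation.TransGen R j k) := ⟨fun _ _ _ h h' => h'.trans h⟩
  have hwf : WellFounded (fun k j => Relation.TransGen R j k) :=
    Finite.wellFounded_of_trans_of_irrefl _
  exact Subrelation.wf (fun h => Relation.TransGen.single h) hwf

theorem eqvGen_of_reflTransGen {ι : Type*} {R : ι → ι → Prop} {a b : ι}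
    (h : Relation.ReflTransGen R a b) : Relation.EqvGen R a b := by
  induction h with
  | refl => exact .refl _
  | tail _ hr ih => exact .trans _ _ _ ih (.rel _ _ hr)

open scoped Classical in
/-- The number of directed `R`-paths from `j` to `i`, characterised by its first-step recursion. -/
def IsPathCount {ι : Type*} [Fintype ι] (R : ι → ι → Prop) (i : ι) (w : ι → ℕ) : Prop :=
  ∀ j, w j = (if j = i then 1 else 0) + ∑ k ∈ Finset.univ.filter (fun k => R j k), w k

open scoped Classical in
theorem exists_isPathCount {ι : Type*} [Fintype ι] {R : ι → ι → Prop}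
    (hwf : WellFounded (fun k j => R j k)) (i : ι) : ∃ w, IsPathCount R i w := by
  refine ⟨hwf.fix (C := fun _ => ℕ) (fun j f => (if j = i then 1 else 0) +
    ∑ k, if h : R j k then f k h else 0), fun j => ?_⟩
  rw [hwf.fix_eq, Finset.sum_filter]
  simp only [dite_eq_ite]

namespace IsPathCount

variable {ι : Type*} [Fintype ι] {R : ι → ι → Prop} {i : ι} {w : ι → ℕ}

theorem eq_zero_of_not_reachable (hw : IsPathCount R i w)
    (hwf : WellFounded (fun k j => R j k)) (j : ι) (hj : ¬ Relation.ReflTransGen R j i) :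
    w j = 0 := by
  classical
  induction j using hwf.induction with
  | _ j ih =>
    have hne : j ≠ i := by rintro rfl; exact hj .refl
    rw [hw j, if_neg hne, zero_add]
    refine Finset.sum_eq_zero fun k hk => ?_
    have hjk : R j k := by simpa using hk
    exact ih k hjk fun h => hj (h.head hjk)

theorem self_eq_one (hw : IsPathCount R i w) (hwf : WellFounded (fun k j => R j k))
    (hacyc : ∀ i, ¬ Relation.TransGen R i i) : w i = 1 := by
  classical
  rw [hw i, if_pos rfl, Nat.add_eq_left]
  refine Finset.sum_eq_zero fun k hk => ?_
  have hik : R i k := by simpa using hk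
  exact hw.eq_zero_of_not_reachable hwf k fun h => hacyc i (Relation.TransGen.head' hik h)

open scoped Classical in
theorem le_one (hw : IsPathCount R i w) (hwf : WellFounded (fun k j => R j k))
    (hacyc : ∀ i, ¬ Relation.TransGen R i i) (j : ι)
    (hj : ∀ k, Relation.ReflTransGen R j k →
      (Finset.univ.filter (fun l => R k l)).card ≤ 1) : w j ≤ 1 := by
  induction j using hwf.induction with
  | _ j ih =>
    by_cases hji : j = i
    · rw [hji, hw.self_eq_one hwf hacyc]
    · rw [hw j, if_neg hji, zero_add]
      have hle := Finset.sum_le_card_nsmul (Finset.univ.filter (fun k => R j k)) w 1 ?_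
      · have := hj j .refl
        simp only [smul_eq_mul, mul_one] at hle
        exact hle.trans this
      · intro k hk
        have hjk : R j k := by simpa using hk
        exact ih k hjk fun l hl => hj l (hl.head hjk)

open scoped Classical in
theorem le_two (hw : IsPathCount R i w) (hwf : WellFounded (fun k j => R j k))
    (hacyc : ∀ i, ¬ Relation.TransGen R i i)
    (hdeg : ∀ j, (Finset.univ.filter (fun i => R j i)).card ≤ 2)
    (huniq : ∀ j j', Relation.EqvGen R j j' →
      (Finset.univ.filter (fun i => R j i)).card = 2 →
      (Finset.univ.filter (fun i => R j' i)).card = 2 → j = j') (j : ι) : w j ≤ 2 := by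
  induction j using hwf.induction with
  | _ j ih =>
    by_cases hji : j = i
    · rw [hji, hw.self_eq_one hwf hacyc]
      exact one_le_two
    · rw [hw j, if_neg hji, zero_add]
      by_cases hcard : (Finset.univ.filter (fun k => R j k)).card = 2
      · have hle := Finset.sum_le_card_nsmul (Finset.univ.filter (fun k => R j k)) w 1 ?_
        · simpa only [hcard, smul_eq_mul, mul_one] using hle
        · intro k hk
          have hjk : R j k := by simpa using hk
          refine hw.le_one hwf hacyc k fun l hl => ?_
          by_contra hl1
          have hl2 := hdeg l
          have hjl : j = l := huniq j l (eqvGen_of_reflTransGen (hl.head hjk)) hcard (by omega)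
          subst hjl
          exact hacyc j (Relation.TransGen.head' hjk hl)
      · have hle := Finset.sum_le_card_nsmul (Finset.univ.filter (fun k => R j k)) w 2 ?_
        · have := hdeg j
          rw [smul_eq_mul] at hle
          exact hle.trans (by omega)
        · intro k hk
          exact ih k (by simpa using hk)

open scoped Classical in
/-- Unrolling `t i ≤ y i + ∑_{j : R j i} t j` weighs each `y j` by the number of paths to `i`. -/
theorem le_sum_mul (hw : IsPathCount R i w) {t y : ι → ℝ}
    (h : ∀ i, t i ≤ y i + ∑ j ∈ Finset.univ.filter (fun j => R j i), t j) :
    t i ≤ ∑ j, (w j : ℝ) * y j := by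
  have hle : ∑ j, (w j : ℝ) * t j ≤
      ∑ j, (w j : ℝ) * y j +
        ∑ j, (w j : ℝ) * ∑ k ∈ Finset.univ.filter (fun k => R k j), t k := by
    rw [← Finset.sum_add_distrib]
    refine Finset.sum_le_sum fun j _ => ?_
    rw [← mul_add]
    exact mul_le_mul_of_nonneg_left (h j) (Nat.cast_nonneg _)
  have hstep : ∑ j, (w j : ℝ) * t j =
      t i + ∑ j, (∑ k ∈ Finset.univ.filter (fun k => R j k), (w k : ℝ)) * t j := by
    have hrec : ∀ j, (w j : ℝ) * t j = (if j = i then t j else 0) +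
        (∑ k ∈ Finset.univ.filter (fun k => R j k), (w k : ℝ)) * t j := by
      intro j
      conv_lhs => rw [hw j]
      push_cast
      rw [add_mul, ite_mul, one_mul, zero_mul]
    rw [Finset.sum_congr rfl fun j _ => hrec j, Finset.sum_add_distrib]
    simp
  have hswap : ∑ j, (w j : ℝ) * ∑ k ∈ Finset.univ.filter (fun k => R k j), t k =
      ∑ j, (∑ k ∈ Finset.univ.filter (fun k => R j k), (w k : ℝ)) * t j := by
    simp only [Finset.sum_filter, Finset.mul_sum, Finset.sum_mul, mul_ite, ite_mul, mul_zero,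
      zero_mul]
    exact Finset.sum_comm
  linarith

end IsPathCount

end PathCount


open scoped Classical in
/-- **Error propagation along the recovery DAG.**
Let `R` be a relation on a finite type whose transitive closure is irreflexive,
with `|T i| ≤ |Y i| + ∑_{j : R j i} |T j|` for all `i`. If every `j` has out-degree
`|{i : R j i}| ≤ 2`, and each equivalence class of the equivalence closure of `R`
contains at most one element of out-degree `2`, then
`|T i| ≤ 2 · ∑_{j in the class of i} |Y j|` for every `i`. -/
theorem error_propagation_dag
    {ι : Type*} [Fintype ι] (R : ι → ι → Prop)
    (hacyc : ∀ i, ¬ Relation.TransGen R i i)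
    (T Y : ι → ℝ)
    (hT : ∀ i, |T i| ≤ |Y i| + ∑ j ∈ Finset.univ.filter (fun j => R j i), |T j|)
    (hdeg : ∀ j, (Finset.univ.filter (fun i => R j i)).card ≤ 2)
    (huniq : ∀ j j', Relation.EqvGen R j j' →
      (Finset.univ.filter (fun i => R j i)).card = 2 →
      (Finset.univ.filter (fun i => R j' i)).card = 2 → j = j') :
    ∀ i, |T i| ≤ 2 * ∑ j ∈ Finset.univ.filter (fun j => Relation.EqvGen R i j), |Y j| := by
  intro i
  have hwf := PathCount.wellFounded_swap_of_acyclic hacyc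
  obtain ⟨w, hw⟩ := PathCount.exists_isPathCount hwf i
  refine (hw.le_sum_mul (t := fun j => |T j|) (y := fun j => |Y j|) hT).trans ?_
  rw [Finset.mul_sum, Finset.sum_filter]
  refine Finset.sum_le_sum fun j _ => ?_
  split_ifs with hij
  · have h2 : (w j : ℝ) ≤ 2 := by exact_mod_cast hw.le_two hwf hacyc hdeg huniq j
    exact mul_le_mul_of_nonneg_right h2 (abs_nonneg _)
  · have h0 : w j = 0 := hw.eq_zero_of_not_reachable hwf j fun h =>
      hij (.symm _ _ (PathCount.eqvGen_of_reflTransGen h))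
    simp [h0]
end
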